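/- arXiv:2108.00337 — 7 statements merged into one kernel-verified Lean document; each statement's English description precedes it below -/
import Mathlib

section
/- If c¹, c² are two nonnegative jointly measurable processes on Ω × [0,T̂) with c¹ ≤ c² P⊗Leb-almost everywhere, then P({ω : c̄¹_t(ω) ≤ c̄²_t(ω) for every t ∈ [0,T̂)}) = 1. In particular, if c¹ = c² P⊗Leb-a.e., then c̄¹ and c̄² are indistinguishable. -/
open MeasureTheory ENNReal Filter Set

noncomputable section

/-- The time interval `[0, T̂)` for a horizon `T̂ ∈ (0,∞]`, encoded as an `EReal`. -/
def timeSet (That : EReal) : Set ℝ := {t : ℝ | 0 ≤ t ∧ (t : EReal) < That}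

/-- Running essential supremum (w.r.t. Lebesgue measure) of an `[0,∞]`-valued function:
`f̄ 0 = 0` and `f̄ t = essSup of f over [0,t]` for `t > 0`. -/
def runEssSupE (f : ℝ → ℝ≥0∞) (t : ℝ) : ℝ≥0∞ :=
  if t = 0 then 0 else essSup f (volume.restrict (Set.Icc (0:ℝ) t))

/-- Running essential supremum of a nonnegative real-valued function, valued in `[0,∞]`. -/
def runEssSup (f : ℝ → ℝ) (t : ℝ) : ℝ≥0∞ :=
  runEssSupE (fun s => ENNReal.ofReal (f s)) t

/-- Almost everywhere domination on `[0, T̂)` passes to the running essential supremum at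
every time before `T̂`. -/
theorem runEssSup_le_of_ae_le {That : EReal} {f g : ℝ → ℝ}
    (hfg : ∀ᵐ s ∂(volume.restrict (timeSet That)), f s ≤ g s) {t : ℝ} (ht : (t : EReal) < That) :
    runEssSup f t ≤ runEssSup g t := by
  have hsub : Set.Icc (0 : ℝ) t ⊆ timeSet That := fun s hs =>
    ⟨hs.1, (EReal.coe_le_coe_iff.2 hs.2).trans_lt ht⟩
  unfold runEssSup runEssSupE
  split_ifs
  · exact le_rfl
  · exact essSup_mono_ae <|
      (ae_restrict_of_ae_restrict_of_subset hsub hfg).mono fun _ h => ENNReal.ofReal_le_ofReal h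

/-- If `c¹ ≤ c²` holds `P⊗Leb`-a.e., then almost surely `c̄¹_t ≤ c̄²_t` for every
`t ∈ [0,T̂)`; in particular, if `c¹ = c²` `P⊗Leb`-a.e. then `c̄¹` and `c̄²` are
indistinguishable. -/
theorem runEssSup_mono_ae
    {Ω : Type*} [MeasurableSpace Ω] (P : Measure Ω) [IsProbabilityMeasure P]
    (That : EReal) (hThat : 0 < That)
    (c₁ c₂ : Ω → ℝ → ℝ)
    (h₁ : Measurable (Function.uncurry c₁)) (h₂ : Measurable (Function.uncurry c₂))
    (hnn₁ : ∀ ω t, 0 ≤ c₁ ω t) (hnn₂ : ∀ ω t, 0 ≤ c₂ ω t)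
    (hle : ∀ᵐ p ∂(P.prod (volume.restrict (timeSet That))), c₁ p.1 p.2 ≤ c₂ p.1 p.2) :
    P {ω | ∀ t : ℝ, 0 ≤ t → (t : EReal) < That →
        runEssSup (c₁ ω) t ≤ runEssSup (c₂ ω) t} = 1 ∧
    ((∀ᵐ p ∂(P.prod (volume.restrict (timeSet That))), c₁ p.1 p.2 = c₂ p.1 p.2) →
      P {ω | ∀ t : ℝ, 0 ≤ t → (t : EReal) < That →
        runEssSup (c₁ ω) t = runEssSup (c₂ ω) t} = 1) := by
  have prob_one {p : Ω → Prop} (h : ∀ᵐ ω ∂P, p ω) : P {ω | p ω} = 1 := by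
    rw [measure_congr (eventuallyEq_univ.2 h), measure_univ]
  refine ⟨prob_one ?_, fun heq => prob_one ?_⟩
  · filter_upwards [Measure.ae_ae_of_ae_prod hle] with ω hω t _ ht
    exact runEssSup_le_of_ae_le hω ht
  · filter_upwards [Measure.ae_ae_of_ae_prod heq] with ω hω t _ ht
    exact le_antisymm (runEssSup_le_of_ae_le (hω.mono fun _ h => h.le) ht)
      (runEssSup_le_of_ae_le (hω.mono fun _ h => h.ge) ht)
end
end

section
/- If c is a nonnegative jointly measurable process on Ω × [0,T̂) and c' is a process with values in [0,∞] whose every path is nondecreasing and left-continuous with c'_0 = 0, and if c ≤ c' P⊗Leb-almost everywhere, then P-almost surely c̄_t ≤ c'_t for all t ∈ [0,T̂). That is, c̄ is the smallest such nondecreasing left-continuous process dominating c. -/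
open MeasureTheory ENNReal Filter Set

noncomputable section

/-- Minimality of the running essential supremum: if `c'` is an `[0,∞]`-valued process
whose paths are nondecreasing and left-continuous on `[0,T̂)` with `c'_0 = 0`, and
`c ≤ c'` `P⊗Leb`-a.e., then `P`-a.s. `c̄_t ≤ c'_t` for all `t ∈ [0,T̂)`. -/
theorem runEssSup_minimal
    {Ω : Type*} [MeasurableSpace Ω] (P : Measure Ω) [IsProbabilityMeasure P]
    (That : EReal) (hThat : 0 < That)
    (c : Ω → ℝ → ℝ) (hmeas : Measurable (Function.uncurry c)) (hnn : ∀ ω t, 0 ≤ c ω t)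
    (c' : Ω → ℝ → ℝ≥0∞)
    (hmono : ∀ ω, MonotoneOn (c' ω) (timeSet That))
    (hlc : ∀ ω, ∀ t : ℝ, 0 < t → (t : EReal) < That →
      Filter.Tendsto (c' ω) (nhdsWithin t (Set.Iio t)) (nhds (c' ω t)))
    (h0 : ∀ ω, c' ω 0 = 0)
    (hle : ∀ᵐ p ∂(P.prod (volume.restrict (timeSet That))),
      ENNReal.ofReal (c p.1 p.2) ≤ c' p.1 p.2) :
    P {ω | ∀ t : ℝ, 0 ≤ t → (t : EReal) < That → runEssSup (c ω) t ≤ c' ω t} = 1 := by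
  have hae : ∀ᵐ ω ∂P, ∀ t : ℝ, 0 ≤ t → (t : EReal) < That → runEssSup (c ω) t ≤ c' ω t := by
    filter_upwards [Measure.ae_ae_of_ae_prod hle] with ω hω t ht htT
    unfold runEssSup runEssSupE
    split_ifs
    · exact zero_le
    · have hsub : Set.Icc 0 t ⊆ timeSet That := fun s hs =>
        ⟨hs.1, (EReal.coe_le_coe_iff.2 hs.2).trans_lt htT⟩
      refine essSup_le_of_ae_le _ ?_
      filter_upwards [ae_restrict_of_ae_restrict_of_subset hsub hω,
        ae_restrict_mem measurableSet_Icc] with s hs hst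
      exact hs.trans (hmono ω (hsub hst) ⟨ht, htT⟩ hst.2)
  rw [measure_congr (eventuallyEq_univ.2 hae), measure_univ]
end
end

section
/- Let D : [0,T̂) → [0,∞) be a nonnegative right-continuous Borel function. Then the following are equivalent: (1) D = 0 μ_c-almost everywhere on [0,T̂); (2) D(t) = 0 for every point of increase t of c, i.e., for every t ∈ [0,T̂) such that c(s) > c(t) for all s ∈ (t,T̂). -/
open MeasureTheory ENNReal Filter Set

noncomputable section

theorem measure_Ico_eq_ofReal_sub {That : EReal} {c : ℝ → ℝ} (h0 : c 0 = 0)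
    (hnn : ∀ t, 0 ≤ c t) {μ : Measure ℝ}
    (hμ : ∀ t : ℝ, 0 < t → (t : EReal) < That → μ (Set.Ico 0 t) = ENNReal.ofReal (c t))
    {a b : ℝ} (ha : 0 ≤ a) (hab : a < b) (hb : (b : EReal) < That) :
    μ (Set.Ico a b) = ENNReal.ofReal (c b - c a) := by
  rcases ha.eq_or_lt with rfl | ha
  · rw [hμ b hab hb, h0, sub_zero]
  have hA := hμ a ha ((EReal.coe_lt_coe_iff.2 hab).trans hb)
  have hdiff : Set.Ico a b = Set.Ico 0 b \ Set.Ico 0 a := by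
    ext x
    simp only [Set.mem_Ico, Set.mem_sdiff, not_and, not_lt]
    exact ⟨fun h => ⟨⟨ha.le.trans h.1, h.2⟩, fun _ => h.1⟩, fun h => ⟨h.2 h.1.1, h.1.2⟩⟩
  rw [hdiff, measure_sdiff (Set.Ico_subset_Ico_right hab.le)
    measurableSet_Ico.nullMeasurableSet (by rw [hA]; exact ENNReal.ofReal_ne_top),
    hμ b (ha.trans hab) hb, hA, ENNReal.ofReal_sub _ (hnn a)]

/-- A set of left endpoints of null intervals with a common right endpoint is null. -/
theorem measure_setOf_left_endpoints_null (μ : Measure ℝ) {s : Set ℝ} {q : ℝ}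
    (hs : ∀ t ∈ s, t < q ∧ μ (Set.Ico t q) = 0) : μ s = 0 := by
  refine measure_null_of_locally_null s fun x hx => ?_
  by_cases h : ∃ y ∈ s, y < x
  · obtain ⟨y, hy, hyx⟩ := h
    exact ⟨Set.Ico y q, mem_nhdsWithin_of_mem_nhds (Ico_mem_nhds hyx (hs x hx).1), (hs y hy).2⟩
  · push Not at h
    exact ⟨Set.Ico x q, mem_of_superset self_mem_nhdsWithin fun y hy => ⟨h y hy, (hs y hy).1⟩,
      (hs x hx).2⟩

/-- For a nondecreasing left-continuous `c : [0,T̂) → [0,∞)` with `c 0 = 0` and associated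
Lebesgue–Stieltjes measure `μ_c` (determined by `μ_c [0,t) = c t`), and a nonnegative
right-continuous Borel `D : [0,T̂) → [0,∞)`, the following are equivalent:
(1) `D = 0` `μ_c`-a.e. on `[0,T̂)`;
(2) `D t = 0` at every point of increase `t` of `c`, i.e. every `t ∈ [0,T̂)` with
`c s > c t` for all `s ∈ (t,T̂)`. -/
theorem zero_ae_stieltjes_iff_zero_at_points_of_increase
    (That : EReal) (hThat : 0 < That)
    (c : ℝ → ℝ) (hnn : ∀ t, 0 ≤ c t) (h0 : c 0 = 0)
    (hmono : MonotoneOn c (timeSet That))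
    (hlc : ∀ t : ℝ, 0 < t → (t : EReal) < That →
      Filter.Tendsto c (nhdsWithin t (Set.Iio t)) (nhds (c t)))
    (μ : Measure ℝ) (hsupp : μ (timeSet That)ᶜ = 0)
    (hμ : ∀ t : ℝ, 0 < t → (t : EReal) < That → μ (Set.Ico 0 t) = ENNReal.ofReal (c t))
    (D : ℝ → ℝ) (hD : Measurable D) (hDnn : ∀ t, 0 ≤ D t)
    (hDrc : ∀ t ∈ timeSet That,
      Filter.Tendsto D (nhdsWithin t (Set.Ioi t)) (nhds (D t))) :
    ((∀ᵐ t ∂(μ.restrict (timeSet That)), D t = 0) ↔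
      ∀ t ∈ timeSet That,
        (∀ s : ℝ, t < s → (s : EReal) < That → c t < c s) → D t = 0) := by
  have hIco : ∀ {a b : ℝ}, 0 ≤ a → a < b → (b : EReal) < That →
      μ (Set.Ico a b) = ENNReal.ofReal (c b - c a) :=
    measure_Ico_eq_ofReal_sub h0 hnn hμ
  rw [ae_restrict_iff (p := fun t => D t = 0) (hD (measurableSet_singleton 0)), ae_iff]
  constructor
  · intro hnull t ht hinc
    by_contra hDt
    have hev : ∀ᶠ x in nhdsWithin t (Set.Ioi t), D x ≠ 0 := (hDrc t ht).eventually_ne hDt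
    obtain ⟨u, htu, hu⟩ := mem_nhdsGT_iff_exists_Ioo_subset.1 hev
    obtain ⟨r, htr, hr⟩ := EReal.lt_iff_exists_real_btwn.1 ht.2
    have hts : t < min u r := lt_min htu (EReal.coe_lt_coe_iff.1 htr)
    have hs : ((min u r : ℝ) : EReal) < That :=
      (EReal.coe_le_coe_iff.2 (min_le_right u r)).trans_lt hr
    have hzero : μ (Set.Ico t (min u r)) = 0 := by
      refine measure_mono_null (fun x hx => ?_) hnull
      simp only [Set.mem_ofPred_eq, Classical.not_imp]
      refine ⟨⟨ht.1.trans hx.1, (EReal.coe_lt_coe_iff.2 hx.2).trans hs⟩, ?_⟩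
      rcases hx.1.eq_or_lt with rfl | htx
      · exact hDt
      · exact hu ⟨htx, hx.2.trans_le (min_le_left u r)⟩
    rw [hIco ht.1 hts hs, ENNReal.ofReal_eq_zero] at hzero
    linarith [hinc _ hts hs]
  · intro hinc
    have hcover : {t | ¬(t ∈ timeSet That → D t = 0)} ⊆
        ⋃ q : ℚ, {t : ℝ | t < q ∧ μ (Set.Ico t q) = 0} := by
      intro t ht
      simp only [Set.mem_ofPred_eq, Classical.not_imp] at ht
      obtain ⟨s, hts, hs, hle⟩ : ∃ s : ℝ, t < s ∧ (s : EReal) < That ∧ c s ≤ c t := by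
        by_contra! h
        exact ht.2 (hinc t ht.1 h)
      obtain ⟨q, htq, hqs⟩ := exists_rat_btwn hts
      refine Set.mem_iUnion.2 ⟨q, htq, measure_mono_null (Set.Ico_subset_Ico_right hqs.le) ?_⟩
      rw [hIco ht.1.1 hts hs, ENNReal.ofReal_eq_zero]
      linarith
    exact measure_mono_null hcover
      (measure_iUnion_null fun q => measure_setOf_left_endpoints_null μ fun _ ht => ht)
end
end

section
/- Let f : [0,T̂) → [0,∞) be Borel measurable, λ ∈ [0,1] and q ∈ ℝ, and set g := f ∨ λ(f̄ ∨ q) (pointwise maximum, with q the constant function). Then the running essential supremum of g satisfies ḡ(t) = f̄(t) ∨ (λq) for every t ∈ (0,T̂) (and ḡ(0) = 0). -/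
open MeasureTheory ENNReal Filter Set

noncomputable section

/-- The running essential supremum is nondecreasing on `[0,∞)`. -/
theorem runEssSupE_mono (f : ℝ → ℝ≥0∞) {s t : ℝ} (hs : 0 ≤ s) (hst : s ≤ t) :
    runEssSupE f s ≤ runEssSupE f t := by
  rcases hs.eq_or_lt with rfl | hs
  · simp [runEssSupE]
  · rw [runEssSupE, runEssSupE, if_neg hs.ne', if_neg (hs.trans_le hst).ne']
    exact essSup_mono_measure
      (Measure.restrict_mono (Icc_subset_Icc_right hst) le_rfl).absolutelyContinuous

/-- The running essential supremum of `f ∨ c (f̄ ∨ d)` with `c ≤ 1`, for `[0,∞]`-valued `f`. -/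
theorem runEssSupE_max_mul_max (f : ℝ → ℝ≥0∞) {c : ℝ≥0∞} (hc : c ≤ 1) (d : ℝ≥0∞)
    {t : ℝ} (ht : 0 < t) :
    runEssSupE (fun s => max (f s) (c * max (runEssSupE f s) d)) t
      = max (runEssSupE f t) (c * d) := by
  have hrun (h : ℝ → ℝ≥0∞) :
      runEssSupE h t = essSup h (volume.restrict (Icc (0 : ℝ) t)) := if_neg ht.ne'
  have hvol : volume.restrict (Icc (0 : ℝ) t) ≠ 0 := by
    simp [Measure.restrict_eq_zero, ht]
  apply le_antisymm
  · rw [hrun]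
    refine essSup_le_of_ae_le _ ?_
    have hf : ∀ᵐ s ∂volume.restrict (Icc (0 : ℝ) t), f s ≤ runEssSupE f t := by
      rw [hrun]
      exact ENNReal.ae_le_essSup f
    filter_upwards [hf, ae_restrict_mem measurableSet_Icc] with s hfs hs
    refine max_le (hfs.trans (le_max_left _ _)) ?_
    rw [mul_max]
    exact max_le_max ((mul_le_of_le_one_left' hc).trans (runEssSupE_mono f hs.1 hs.2)) le_rfl
  · refine max_le ?_ ?_
    · rw [hrun, hrun]
      exact essSup_mono_ae (Eventually.of_forall fun s => le_max_left _ _)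
    · rw [hrun, ← essSup_const (c * d) hvol]
      exact essSup_mono_ae (Eventually.of_forall fun s =>
        (mul_le_mul_right (le_max_right _ _) c).trans (le_max_right _ _))

/-- For `g := f ∨ λ(f̄ ∨ q)`, the running essential supremum of `g` satisfies
`ḡ t = f̄ t ∨ (λq)` for every `t ∈ (0,T̂)` (and `ḡ 0 = 0`). -/
theorem runEssSup_of_max_drawdown
    (That : EReal) (hThat : 0 < That)
    (f : ℝ → ℝ) (hf : Measurable f) (hnn : ∀ t, 0 ≤ f t)
    (lam q : ℝ) (hlam : lam ∈ Set.Icc (0:ℝ) 1) :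
    (runEssSupE (fun s => max (ENNReal.ofReal (f s))
        (ENNReal.ofReal lam * max (runEssSup f s) (ENNReal.ofReal q))) 0 = 0) ∧
    ∀ t : ℝ, 0 < t → (t : EReal) < That →
      runEssSupE (fun s => max (ENNReal.ofReal (f s))
          (ENNReal.ofReal lam * max (runEssSup f s) (ENNReal.ofReal q))) t
        = max (runEssSup f t) (ENNReal.ofReal (lam * q)) := by
  refine ⟨if_pos rfl, fun t ht _ => ?_⟩
  rw [ENNReal.ofReal_mul hlam.1]
  exact runEssSupE_max_mul_max _ (ENNReal.ofReal_le_one.2 hlam.2) _ ht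
end
end

section
/- For every λ ∈ [0,1], the set C^λ := {c ≥ 0 jointly measurable : E[∫_0^{T̂} (c ∨ λc̄)_t Z_t dκ_t] ≤ 1 for all Z ∈ 𝒵} is convex, solid (if 0 ≤ c' ≤ c P⊗dκ-a.e. and c ∈ C^λ then c' ∈ C^λ), and closed with respect to convergence in the finite measure P⊗dκ on Ω × [0,T̂). -/
open MeasureTheory ENNReal Filter Set

noncomputable section

variable {Ω : Type*}

/-- The measure `P ⊗ dκ` on `Ω × [0,T̂)`. -/
def Pkappa [MeasurableSpace Ω] (P : Measure Ω) (That : EReal) (kdot : Ω → ℝ → ℝ) :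
    Measure (Ω × ℝ) :=
  (P.prod (volume.restrict (timeSet That))).withDensity fun p => ENNReal.ofReal (kdot p.1 p.2)

/-- `E[∫_0^T̂ c_t δ_t dκ_t]` for an `[0,∞]`-valued process `c` and a real process `δ`. -/
def pairE [MeasurableSpace Ω] (P : Measure Ω) (That : EReal) (kdot : Ω → ℝ → ℝ)
    (c : Ω → ℝ → ℝ≥0∞) (δ : Ω → ℝ → ℝ) : ℝ≥0∞ :=
  ∫⁻ ω, ∫⁻ t in timeSet That,
    c ω t * ENNReal.ofReal (δ ω t) * ENNReal.ofReal (kdot ω t) ∂volume ∂P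

theorem measurableSet_timeSet (That : EReal) : MeasurableSet (timeSet That) :=
  measurableSet_Ici.inter (measurable_coe_real_ereal measurableSet_Iio)

theorem Icc_subset_timeSet {That : EReal} {t : ℝ} (ht : t ∈ timeSet That) :
    Set.Icc (0 : ℝ) t ⊆ timeSet That := fun _ hs =>
  ⟨hs.1, lt_of_le_of_lt (EReal.coe_le_coe_iff.2 hs.2) ht.2⟩

theorem measurable_runEssSup [MeasurableSpace Ω] {c : Ω → ℝ → ℝ}
    (hc : Measurable (Function.uncurry c)) :
    Measurable fun p : Ω × ℝ => runEssSup (c p.1) p.2 := by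
  unfold runEssSup runEssSupE
  refine Measurable.ite (measurableSet_eq_fun measurable_snd measurable_const)
    measurable_const ?_
  refine measurable_of_Iic fun a => ?_
  have hS : MeasurableSet {q : (Ω × ℝ) × ℝ |
      (0 ≤ q.2 ∧ q.2 ≤ q.1.2) ∧ a < ENNReal.ofReal (c q.1.1 q.2)} := by
    have hc' : Measurable fun q : (Ω × ℝ) × ℝ => ENNReal.ofReal (c q.1.1 q.2) :=
      (hc.comp (f := fun q : (Ω × ℝ) × ℝ => (q.1.1, q.2)) (by fun_prop)).ennreal_ofReal
    exact ((measurableSet_le measurable_const measurable_snd).inter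
      (measurableSet_le measurable_snd measurable_fst.snd)).inter
      (measurableSet_lt measurable_const hc')
  convert measurable_measure_prodMk_left (ν := (volume : Measure ℝ)) hS
    (measurableSet_singleton 0) using 1
  ext p
  have h : essSup (fun s => ENNReal.ofReal (c p.1 s)) (volume.restrict (Set.Icc 0 p.2)) ≤ a ↔
      ∀ᵐ s ∂volume.restrict (Set.Icc 0 p.2), ENNReal.ofReal (c p.1 s) ≤ a :=
    ⟨fun h => (ENNReal.ae_le_essSup _).mono fun s hs => hs.trans h, fun h =>
      essSup_le_of_ae_le _ h⟩
  rw [Set.mem_preimage, Set.mem_Iic, h, ae_restrict_iff' measurableSet_Icc, ae_iff]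
  simp [Set.preimage, and_assoc]

/-- The process `c ∨ λ c̄`. -/
def maxRun (lam : ℝ) (c : Ω → ℝ → ℝ) (ω : Ω) (t : ℝ) : ℝ≥0∞ :=
  max (ENNReal.ofReal (c ω t)) (ENNReal.ofReal lam * runEssSup (c ω) t)

theorem measurable_maxRun [MeasurableSpace Ω] {c : Ω → ℝ → ℝ}
    (hc : Measurable (Function.uncurry c)) (lam : ℝ) :
    Measurable fun p : Ω × ℝ => maxRun lam c p.1 p.2 :=
  (show Measurable fun p : Ω × ℝ => ENNReal.ofReal (c p.1 p.2) from hc.ennreal_ofReal).max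
    ((measurable_runEssSup hc).const_mul _)

theorem measurable_mul_density [MeasurableSpace Ω] {kdot : Ω → ℝ → ℝ}
    (hk : Measurable (Function.uncurry kdot)) {c : Ω → ℝ → ℝ≥0∞}
    (hc : Measurable fun p : Ω × ℝ => c p.1 p.2) {Z : Ω → ℝ → ℝ}
    (hZ : Measurable (Function.uncurry Z)) :
    Measurable fun p : Ω × ℝ =>
      c p.1 p.2 * (ENNReal.ofReal (Z p.1 p.2) * ENNReal.ofReal (kdot p.1 p.2)) :=
  hc.mul (hZ.ennreal_ofReal.mul hk.ennreal_ofReal)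

theorem pairE_eq_lintegral_prod [MeasurableSpace Ω] (P : Measure Ω) (That : EReal)
    {kdot : Ω → ℝ → ℝ} (hk : Measurable (Function.uncurry kdot)) {c : Ω → ℝ → ℝ≥0∞}
    (hc : Measurable fun p : Ω × ℝ => c p.1 p.2) {Z : Ω → ℝ → ℝ}
    (hZ : Measurable (Function.uncurry Z)) :
    pairE P That kdot c Z = ∫⁻ p, c p.1 p.2 * (ENNReal.ofReal (Z p.1 p.2) *
      ENNReal.ofReal (kdot p.1 p.2)) ∂(P.prod (volume.restrict (timeSet That))) := by
  rw [lintegral_prod _ (measurable_mul_density hk hc hZ).aemeasurable]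
  simp only [pairE, mul_assoc]

theorem runEssSup_mono_of_ae {f g : ℝ → ℝ} {t : ℝ}
    (h : ∀ᵐ s ∂volume.restrict (Set.Icc 0 t), f s ≤ g s) :
    runEssSup f t ≤ runEssSup g t := by
  unfold runEssSup runEssSupE
  split_ifs
  · exact le_rfl
  · exact essSup_mono_ae (h.mono fun s hs => ENNReal.ofReal_le_ofReal hs)

theorem runEssSup_convex_comb_le {f g : ℝ → ℝ} (hf : ∀ s, 0 ≤ f s) (hg : ∀ s, 0 ≤ g s)
    {a b : ℝ} (ha : 0 ≤ a) (hb : 0 ≤ b) (t : ℝ) :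
    runEssSup (fun s => a * f s + b * g s) t ≤
      ENNReal.ofReal a * runEssSup f t + ENNReal.ofReal b * runEssSup g t := by
  unfold runEssSup runEssSupE
  split_ifs
  · simp
  · refine essSup_le_of_ae_le _ ?_
    filter_upwards [ENNReal.ae_le_essSup (μ := volume.restrict (Set.Icc 0 t))
      (fun s => ENNReal.ofReal (f s)), ENNReal.ae_le_essSup (μ := volume.restrict (Set.Icc 0 t))
      (fun s => ENNReal.ofReal (g s))] with s h₁ h₂
    rw [ENNReal.ofReal_add (mul_nonneg ha (hf s)) (mul_nonneg hb (hg s)),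
      ENNReal.ofReal_mul ha, ENNReal.ofReal_mul hb]
    gcongr

theorem maxRun_convex_comb_le {c₁ c₂ : Ω → ℝ → ℝ} (h₁ : ∀ ω t, 0 ≤ c₁ ω t)
    (h₂ : ∀ ω t, 0 ≤ c₂ ω t) {a b : ℝ} (ha : 0 ≤ a) (hb : 0 ≤ b) (lam : ℝ) (ω : Ω) (t : ℝ) :
    maxRun lam (fun ω t => a * c₁ ω t + b * c₂ ω t) ω t ≤
      ENNReal.ofReal a * maxRun lam c₁ ω t + ENNReal.ofReal b * maxRun lam c₂ ω t := by
  refine max_le ?_ ?_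
  · rw [ENNReal.ofReal_add (mul_nonneg ha (h₁ ω t)) (mul_nonneg hb (h₂ ω t)),
      ENNReal.ofReal_mul ha, ENNReal.ofReal_mul hb]
    gcongr <;> exact le_max_left _ _
  · calc ENNReal.ofReal lam * runEssSup (fun s => a * c₁ ω s + b * c₂ ω s) t
        ≤ ENNReal.ofReal lam * (ENNReal.ofReal a * runEssSup (c₁ ω) t +
            ENNReal.ofReal b * runEssSup (c₂ ω) t) := by
          gcongr
          exact runEssSup_convex_comb_le (h₁ ω) (h₂ ω) ha hb t
      _ = ENNReal.ofReal a * (ENNReal.ofReal lam * runEssSup (c₁ ω) t) +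
            ENNReal.ofReal b * (ENNReal.ofReal lam * runEssSup (c₂ ω) t) := by ring
      _ ≤ _ := by gcongr <;> exact le_max_right _ _

theorem runEssSup_le_liminf {f : ℝ → ℝ} {u : ℕ → ℝ → ℝ} {t : ℝ}
    (h : ∀ᵐ s ∂volume.restrict (Set.Icc 0 t), Tendsto (fun n => u n s) atTop (nhds (f s))) :
    runEssSup f t ≤ liminf (fun n => runEssSup (u n) t) atTop := by
  unfold runEssSup runEssSupE
  split_ifs
  · exact zero_le
  · refine essSup_le_of_ae_le _ ?_
    have h' : ∀ᵐ s ∂volume.restrict (Set.Icc 0 t), ∀ n, ENNReal.ofReal (u n s) ≤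
        essSup (fun s => ENNReal.ofReal (u n s)) (volume.restrict (Set.Icc 0 t)) :=
      ae_all_iff.2 fun n => ENNReal.ae_le_essSup _
    filter_upwards [h, h'] with s hs hs'
    rw [← (ENNReal.tendsto_ofReal hs).liminf_eq]
    exact liminf_le_liminf (Eventually.of_forall hs')

theorem maxRun_le_liminf {c : Ω → ℝ → ℝ} {u : ℕ → Ω → ℝ → ℝ} {ω : Ω} {t : ℝ} (lam : ℝ)
    (ht : Tendsto (fun n => u n ω t) atTop (nhds (c ω t)))
    (h : ∀ᵐ s ∂volume.restrict (Set.Icc 0 t),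
      Tendsto (fun n => u n ω s) atTop (nhds (c ω s))) :
    maxRun lam c ω t ≤ liminf (fun n => maxRun lam (u n) ω t) atTop := by
  refine max_le ?_ ?_
  · rw [← (ENNReal.tendsto_ofReal ht).liminf_eq]
    exact liminf_le_liminf (Eventually.of_forall fun n => le_max_left _ _)
  · calc _ ≤ ENNReal.ofReal lam * liminf (fun n => runEssSup (u n ω) t) atTop := by
          gcongr
          exact runEssSup_le_liminf h
      _ = _ := (ENNReal.liminf_const_mul_of_ne_top ENNReal.ofReal_ne_top).symm
      _ ≤ _ := liminf_le_liminf (Eventually.of_forall fun n => le_max_right _ _)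

theorem ae_ae_of_ae_Pkappa [MeasurableSpace Ω] {P : Measure Ω} [SFinite P] {That : EReal}
    {kdot : Ω → ℝ → ℝ} (hk : Measurable (Function.uncurry kdot))
    (hkpos : ∀ ω, ∀ t ∈ timeSet That, 0 < kdot ω t) {p : Ω × ℝ → Prop}
    (h : ∀ᵐ q ∂Pkappa P That kdot, p q) :
    ∀ᵐ ω ∂P, ∀ᵐ t ∂volume.restrict (timeSet That), p (ω, t) := by
  replace h := (ae_withDensity_iff hk.ennreal_ofReal).1 h
  filter_upwards [Measure.ae_ae_of_ae_prod h] with ω hω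
  filter_upwards [hω, ae_restrict_mem (measurableSet_timeSet That)] with t h₁ ht
  exact h₁ (ENNReal.ofReal_pos.2 (hkpos ω t ht)).ne'

theorem ae_ae_and_ae_Icc_of_ae_Pkappa [MeasurableSpace Ω] {P : Measure Ω} [SFinite P]
    {That : EReal} {kdot : Ω → ℝ → ℝ} (hk : Measurable (Function.uncurry kdot))
    (hkpos : ∀ ω, ∀ t ∈ timeSet That, 0 < kdot ω t) {p : Ω × ℝ → Prop}
    (h : ∀ᵐ q ∂Pkappa P That kdot, p q) :
    ∀ᵐ ω ∂P, ∀ᵐ t ∂volume.restrict (timeSet That),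
      p (ω, t) ∧ ∀ᵐ s ∂volume.restrict (Set.Icc 0 t), p (ω, s) := by
  filter_upwards [ae_ae_of_ae_Pkappa hk hkpos h] with ω hω
  filter_upwards [hω, ae_restrict_mem (measurableSet_timeSet That)] with t h₁ ht
  exact ⟨h₁, ae_restrict_of_ae_restrict_of_subset (Icc_subset_timeSet ht) hω⟩

theorem pairE_mono_ae [MeasurableSpace Ω] {P : Measure Ω} {That : EReal} {kdot Z : Ω → ℝ → ℝ}
    {c d : Ω → ℝ → ℝ≥0∞}
    (h : ∀ᵐ ω ∂P, ∀ᵐ t ∂volume.restrict (timeSet That), c ω t ≤ d ω t) :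
    pairE P That kdot c Z ≤ pairE P That kdot d Z :=
  lintegral_mono_ae <| h.mono fun _ hω => lintegral_mono_ae <| hω.mono fun _ ht => by gcongr

theorem pairE_liminf_le [MeasurableSpace Ω] (P : Measure Ω) [SFinite P] (That : EReal)
    {kdot : Ω → ℝ → ℝ} (hk : Measurable (Function.uncurry kdot)) {d : ℕ → Ω → ℝ → ℝ≥0∞}
    (hd : ∀ n, Measurable fun p : Ω × ℝ => d n p.1 p.2) {Z : Ω → ℝ → ℝ}
    (hZ : Measurable (Function.uncurry Z)) :
    pairE P That kdot (fun ω t => liminf (fun n => d n ω t) atTop) Z ≤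
      liminf (fun n => pairE P That kdot (d n) Z) atTop := by
  simp_rw [pairE_eq_lintegral_prod P That hk (hd _) hZ]
  rw [pairE_eq_lintegral_prod P That hk (Measurable.liminf hd) hZ]
  refine le_trans (lintegral_mono fun p => ?_)
    (lintegral_liminf_le fun n => measurable_mul_density hk (hd n) hZ)
  simp only [mul_comm _ (ENNReal.ofReal (Z p.1 p.2) * ENNReal.ofReal (kdot p.1 p.2))]
  exact (ENNReal.liminf_const_mul_of_ne_top
    (ENNReal.mul_ne_top ENNReal.ofReal_ne_top ENNReal.ofReal_ne_top)).ge

theorem pairE_add_mul [MeasurableSpace Ω] (P : Measure Ω) [SFinite P] (That : EReal)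
    {kdot : Ω → ℝ → ℝ} (hk : Measurable (Function.uncurry kdot)) {d₁ d₂ : Ω → ℝ → ℝ≥0∞}
    (h₁ : Measurable fun p : Ω × ℝ => d₁ p.1 p.2) (h₂ : Measurable fun p : Ω × ℝ => d₂ p.1 p.2)
    {Z : Ω → ℝ → ℝ} (hZ : Measurable (Function.uncurry Z)) (a b : ℝ≥0∞) :
    pairE P That kdot (fun ω t => a * d₁ ω t + b * d₂ ω t) Z =
      a * pairE P That kdot d₁ Z + b * pairE P That kdot d₂ Z := by
  rw [pairE_eq_lintegral_prod P That hk ((h₁.const_mul a).add (h₂.const_mul b)) hZ,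
    pairE_eq_lintegral_prod P That hk h₁ hZ, pairE_eq_lintegral_prod P That hk h₂ hZ,
    ← lintegral_const_mul _ (measurable_mul_density hk h₁ hZ),
    ← lintegral_const_mul _ (measurable_mul_density hk h₂ hZ),
    ← lintegral_add_left ((measurable_mul_density hk h₁ hZ).const_mul a)]
  simp only [add_mul, mul_assoc]

/-- For every `λ ∈ [0,1]`, the set `C^λ = {c ≥ 0 : E[∫ (c ∨ λc̄) Z dκ] ≤ 1 ∀ Z ∈ 𝒵}` is
convex, solid, and closed with respect to convergence in the finite measure `P⊗dκ`. -/
theorem Clambda_convex_solid_closed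
    [MeasurableSpace Ω] (P : Measure Ω) [IsProbabilityMeasure P]
    (That : EReal) (hThat : 0 < That)
    (kdot : Ω → ℝ → ℝ) (hkmeas : Measurable (Function.uncurry kdot))
    (hkpos : ∀ ω, ∀ t ∈ timeSet That, 0 < kdot ω t)
    (A : ℝ) (hkbdd : ∀ ω, (∫⁻ t in timeSet That, ENNReal.ofReal (kdot ω t)) ≤ ENNReal.ofReal A)
    (𝒵 : Set (Ω → ℝ → ℝ))
    (h𝒵 : ∀ Z ∈ 𝒵, (∀ ω t, 0 ≤ Z ω t) ∧ Measurable (Function.uncurry Z))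
    (lam : ℝ) (hlam : lam ∈ Set.Icc (0:ℝ) 1) :
    let C : Set (Ω → ℝ → ℝ) := {c | (∀ ω t, 0 ≤ c ω t) ∧ Measurable (Function.uncurry c) ∧
      ∀ Z ∈ 𝒵, pairE P That kdot
        (fun ω t => max (ENNReal.ofReal (c ω t)) (ENNReal.ofReal lam * runEssSup (c ω) t))
        Z ≤ 1}
    -- convex
    ((∀ c₁ ∈ C, ∀ c₂ ∈ C, ∀ θ : ℝ, 0 ≤ θ → θ ≤ 1 →
      (fun ω t => θ * c₁ ω t + (1 - θ) * c₂ ω t) ∈ C)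
    ∧
    -- solid
    (∀ c ∈ C, ∀ c' : Ω → ℝ → ℝ, (∀ ω t, 0 ≤ c' ω t) → Measurable (Function.uncurry c') →
      (∀ᵐ p ∂(Pkappa P That kdot), c' p.1 p.2 ≤ c p.1 p.2) → c' ∈ C)
    ∧
    -- closed with respect to convergence in measure `P⊗dκ`
    (∀ u : ℕ → Ω → ℝ → ℝ, (∀ n, u n ∈ C) → ∀ c : Ω → ℝ → ℝ,
      (∀ ω t, 0 ≤ c ω t) → Measurable (Function.uncurry c) →
      TendstoInMeasure (Pkappa P That kdot) (fun n => Function.uncurry (u n)) Filter.atTop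
        (Function.uncurry c) →
      c ∈ C)) := by
  intro C
  refine ⟨?_, ?_, ?_⟩
  · rintro c₁ ⟨hn₁, hm₁, hb₁⟩ c₂ ⟨hn₂, hm₂, hb₂⟩ θ hθ hθ'
    have hθ'' : 0 ≤ 1 - θ := sub_nonneg.2 hθ'
    refine ⟨fun ω t => add_nonneg (mul_nonneg hθ (hn₁ ω t)) (mul_nonneg hθ'' (hn₂ ω t)),
      (hm₁.const_mul θ).add (hm₂.const_mul (1 - θ)), fun Z hZ => ?_⟩
    calc _ ≤ pairE P That kdot (fun ω t => ENNReal.ofReal θ * maxRun lam c₁ ω t +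
            ENNReal.ofReal (1 - θ) * maxRun lam c₂ ω t) Z :=
          pairE_mono_ae (ae_of_all _ fun ω => ae_of_all _ fun t =>
            maxRun_convex_comb_le hn₁ hn₂ hθ hθ'' lam ω t)
      _ = ENNReal.ofReal θ * pairE P That kdot (maxRun lam c₁) Z +
            ENNReal.ofReal (1 - θ) * pairE P That kdot (maxRun lam c₂) Z :=
          pairE_add_mul P That hkmeas (measurable_maxRun hm₁ lam) (measurable_maxRun hm₂ lam)
            (h𝒵 Z hZ).2 _ _
      _ ≤ ENNReal.ofReal θ * 1 + ENNReal.ofReal (1 - θ) * 1 := by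
          gcongr
          exacts [hb₁ Z hZ, hb₂ Z hZ]
      _ = 1 := by
          rw [mul_one, mul_one, ← ENNReal.ofReal_add hθ hθ'']
          simp
  · rintro c ⟨-, -, hb⟩ c' hn' hm' hle
    refine ⟨hn', hm', fun Z hZ => (pairE_mono_ae ?_).trans (hb Z hZ)⟩
    filter_upwards [ae_ae_and_ae_Icc_of_ae_Pkappa hkmeas hkpos hle] with ω hω
    filter_upwards [hω] with t ht
    exact max_le_max (ENNReal.ofReal_le_ofReal ht.1) (by gcongr; exact runEssSup_mono_of_ae ht.2)
  · intro u hu c hn hm hlim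
    obtain ⟨ns, -, hns⟩ := hlim.exists_seq_tendsto_ae
    refine ⟨hn, hm, fun Z hZ => ?_⟩
    calc _ ≤ pairE P That kdot
            (fun ω t => liminf (fun n => maxRun lam (u (ns n)) ω t) atTop) Z := by
          refine pairE_mono_ae ?_
          filter_upwards [ae_ae_and_ae_Icc_of_ae_Pkappa hkmeas hkpos hns] with ω hω
          filter_upwards [hω] with t ht
          exact maxRun_le_liminf (u := fun n => u (ns n)) lam ht.1 ht.2
      _ ≤ liminf (fun n => pairE P That kdot (maxRun lam (u (ns n))) Z) atTop :=
          pairE_liminf_le P That hkmeas (fun n => measurable_maxRun (hu (ns n)).2.1 lam)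
            (h𝒵 Z hZ).2
      _ ≤ liminf (fun _ : ℕ => (1 : ℝ≥0∞)) atTop :=
          liminf_le_liminf (Eventually.of_forall fun n => (hu (ns n)).2.2 Z hZ)
      _ = 1 := liminf_const _
end
end

section
/- For two nonnegative progressively measurable processes δ̃ and δ, the following are equivalent: (i) δ̃ ⪯ δ; (ii) E[∫_0^{T̂} c_t δ̃_t dκ_t] ≤ E[∫_0^{T̂} c_t δ_t dκ_t] for every adapted process c with values in [0,∞] whose every path is nondecreasing and left-continuous with c_0 = 0. -/
open MeasureTheory ENNReal Filter Set

noncomputable section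

variable {Ω : Type*}

/-- `⟨c, δ⟩ = E[∫_0^T̂ c_t δ_t dκ_t]` for real-valued processes. -/
def pairR [MeasurableSpace Ω] (P : Measure Ω) (That : EReal) (kdot : Ω → ℝ → ℝ)
    (c δ : Ω → ℝ → ℝ) : ℝ≥0∞ :=
  pairE P That kdot (fun ω t => ENNReal.ofReal (c ω t)) δ

/-- A stopping time with values in `[0,T̂]` for the filtration `(F_t)`. -/
def IsStopTime {m : MeasurableSpace Ω} (ℱ : Filtration ℝ m) (That : EReal)
    (T : Ω → EReal) : Prop :=
  (∀ ω, 0 ≤ T ω ∧ T ω ≤ That) ∧ ∀ t : ℝ, MeasurableSet[ℱ t] {ω | T ω ≤ (t : EReal)}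

/-- `E[∫_T^T̂ δ_t dκ_t]` for a stopping time `T`. -/
def tailInt [MeasurableSpace Ω] (P : Measure Ω) (That : EReal) (kdot : Ω → ℝ → ℝ)
    (δ : Ω → ℝ → ℝ) (T : Ω → EReal) : ℝ≥0∞ :=
  ∫⁻ ω, ∫⁻ t in timeSet That ∩ {t : ℝ | T ω ≤ (t : EReal)},
    ENNReal.ofReal (δ ω t) * ENNReal.ofReal (kdot ω t) ∂volume ∂P

/-- The chronological ordering `δ' ⪯ δ`:
`E[∫_T^T̂ δ' dκ] ≤ E[∫_T^T̂ δ dκ]` for every stopping time `T` with values in `[0,T̂]`. -/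
def chronLE {m : MeasurableSpace Ω} (P : Measure Ω) (That : EReal) (kdot : Ω → ℝ → ℝ)
    (ℱ : Filtration ℝ m) (δ' δ : Ω → ℝ → ℝ) : Prop :=
  ∀ T : Ω → EReal, IsStopTime ℱ That T →
    tailInt P That kdot δ' T ≤ tailInt P That kdot δ T

/-- The interpolated ordering `δ' ⪯_λ δ`: there are decompositions `δ = δ¹ + δ²`,
`δ' = δ'¹ + δ'²` into nonnegative progressively measurable processes with
`δ'¹ ≤ δ¹` `P⊗dκ`-a.e. and `δ'² ⪯ λδ²`. -/
def chronLElam {m : MeasurableSpace Ω} (P : Measure Ω) (That : EReal) (kdot : Ω → ℝ → ℝ)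
    (ℱ : Filtration ℝ m) (lam : ℝ) (δ' δ : Ω → ℝ → ℝ) : Prop :=
  ∃ δ₁ δ₂ δ'₁ δ'₂ : Ω → ℝ → ℝ,
    (∀ ω t, 0 ≤ δ₁ ω t) ∧ (∀ ω t, 0 ≤ δ₂ ω t) ∧
    (∀ ω t, 0 ≤ δ'₁ ω t) ∧ (∀ ω t, 0 ≤ δ'₂ ω t) ∧
    ProgMeasurable ℱ (fun t ω => δ₁ ω t) ∧ ProgMeasurable ℱ (fun t ω => δ₂ ω t) ∧
    ProgMeasurable ℱ (fun t ω => δ'₁ ω t) ∧ ProgMeasurable ℱ (fun t ω => δ'₂ ω t) ∧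
    (∀ ω t, δ ω t = δ₁ ω t + δ₂ ω t) ∧ (∀ ω t, δ' ω t = δ'₁ ω t + δ'₂ ω t) ∧
    (∀ᵐ p ∂(Pkappa P That kdot), δ'₁ p.1 p.2 ≤ δ₁ p.1 p.2) ∧
    chronLE P That kdot ℱ δ'₂ (fun ω t => lam * δ₂ ω t)

/-- A progressively measurable process is jointly measurable. -/
theorem measurable_uncurry_of_isStronglyProgressive {m : MeasurableSpace Ω} {ℱ : Filtration ℝ m}
    {X : Ω → ℝ → ℝ} (hX : IsStronglyProgressive ℱ (fun t ω => X ω t)) :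
    Measurable fun p : Ω × ℝ => X p.1 p.2 := by
  have hlim : ∀ p : Ω × ℝ, Tendsto (fun n : ℕ => X p.1 (min p.2 n)) atTop (nhds (X p.1 p.2)) := by
    intro p
    obtain ⟨N, hN⟩ := exists_nat_ge p.2
    refine tendsto_atTop_of_eventually_const (i₀ := N) fun n hn => ?_
    rw [min_eq_left (hN.trans (by exact_mod_cast hn))]
  refine measurable_of_tendsto_metrizable (fun n : ℕ => ?_) (tendsto_pi_nhds.2 hlim)
  have hcomp : Measurable[_, Subtype.instMeasurableSpace.prod (ℱ (n : ℝ))]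
      fun p : Ω × ℝ => ((⟨min p.2 n, mem_Iic.2 (min_le_right _ _)⟩ : Iic (n : ℝ)), p.1) :=
    Measurable.prodMk (measurable_snd.min measurable_const).subtype_mk
      (measurable_fst.mono le_rfl (ℱ.le n))
  exact (hX n).measurable.comp hcomp

/-- Layer-cake formula for an `[0,∞]`-valued weight. -/
theorem lintegral_mul_eq_lintegral_setLIntegral_superlevel {α : Type*} [MeasurableSpace α]
    (μ : Measure α) [SFinite μ] {f g : α → ℝ≥0∞} (hf : Measurable f) (hg : Measurable g) :
    ∫⁻ x, f x * g x ∂μ =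
      ∫⁻ s in Ioi (0 : ℝ), ∫⁻ x in {x | ENNReal.ofReal s < f x}, g x ∂μ := by
  have hlayer : ∀ a : ℝ≥0∞, a = ∫⁻ s in Ioi (0 : ℝ), {s | ENNReal.ofReal s < a}.indicator 1 s := by
    intro a
    have hms : MeasurableSet {s : ℝ | ENNReal.ofReal s < a} :=
      measurableSet_lt ENNReal.measurable_ofReal measurable_const
    rw [lintegral_indicator_one hms, Measure.restrict_apply hms]
    induction a with
    | top => simp
    | coe a =>
      have : {s : ℝ | ENNReal.ofReal s < a} ∩ Ioi 0 = Ioo 0 (a : ℝ) := by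
        ext s
        simp only [mem_inter_iff, mem_ofPred_eq, mem_Ioi, mem_Ioo]
        constructor
        · rintro ⟨h, hs⟩
          exact ⟨hs, by simpa using (ENNReal.ofReal_lt_iff_lt_toReal hs.le (by simp)).1 h⟩
        · rintro ⟨hs, h⟩
          exact ⟨(ENNReal.ofReal_lt_iff_lt_toReal hs.le (by simp)).2 (by simpa using h), hs⟩
      rw [this]
      simp
  have hms : MeasurableSet {q : α × ℝ | ENNReal.ofReal q.2 < f q.1} :=
    measurableSet_lt (ENNReal.measurable_ofReal.comp measurable_snd) (hf.comp measurable_fst)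
  calc ∫⁻ x, f x * g x ∂μ
      = ∫⁻ x, (∫⁻ s in Ioi (0 : ℝ),
          {q : α × ℝ | ENNReal.ofReal q.2 < f q.1}.indicator (fun q => g q.1) (x, s)) ∂μ := by
        refine lintegral_congr fun x => ?_
        conv_lhs => rw [hlayer (f x)]
        rw [← lintegral_mul_const _ (measurable_one.indicator
          (measurableSet_lt ENNReal.measurable_ofReal measurable_const))]
        refine lintegral_congr fun s => ?_
        simp [indicator_apply]
    _ = ∫⁻ s in Ioi (0 : ℝ), ∫⁻ x,
          {q : α × ℝ | ENNReal.ofReal q.2 < f q.1}.indicator (fun q => g q.1) (x, s) ∂μ :=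
        lintegral_lintegral_swap (f := fun x s =>
          {q : α × ℝ | ENNReal.ofReal q.2 < f q.1}.indicator (fun q => g q.1) (x, s)) ((hg.comp measurable_fst).indicator hms).aemeasurable
    _ = _ := by
        refine lintegral_congr fun s => ?_
        rw [← lintegral_indicator (measurableSet_lt measurable_const hf)]
        rfl

/-- The first time in `[0,T̂)` at which the path `x` exceeds the level `a`, or `T̂` if there is
none. -/
def exceedTime (That : EReal) (x : ℝ → ℝ≥0∞) (a : ℝ≥0∞) : EReal :=
  That ⊓ ⨅ (r : ℝ) (_ : r ∈ timeSet That ∧ a < x r), (r : EReal)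

theorem exceedTime_le (That : EReal) (x : ℝ → ℝ≥0∞) (a : ℝ≥0∞) : exceedTime That x a ≤ That :=
  inf_le_left

theorem exceedTime_nonneg {That : EReal} (hThat : 0 < That) (x : ℝ → ℝ≥0∞) (a : ℝ≥0∞) :
    0 ≤ exceedTime That x a :=
  le_inf hThat.le (le_iInf₂ fun _ hr => by exact_mod_cast hr.1.1)

/-- Before the horizon, a path that is nondecreasing has exceeded a level strictly before `t` iff
it exceeds it at some earlier rational time. -/
theorem exceedTime_lt_iff {That : EReal} {x : ℝ → ℝ≥0∞} (hx : MonotoneOn x (timeSet That))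
    (a : ℝ≥0∞) {t : ℝ} (ht : (t : EReal) ≤ That) :
    exceedTime That x a < t ↔ ∃ q : ℚ, (q : ℝ) < t ∧ (q : ℝ) ∈ timeSet That ∧ a < x q := by
  simp only [exceedTime, inf_lt_iff, not_lt.2 ht, false_or, iInf_lt_iff, exists_prop]
  constructor
  · rintro ⟨r, ⟨hr, har⟩, hrt⟩
    obtain ⟨q, hrq, hqt⟩ := exists_rat_btwn (EReal.coe_lt_coe_iff.1 hrt)
    have hq : (q : ℝ) ∈ timeSet That :=
      ⟨hr.1.trans hrq.le, (EReal.coe_lt_coe_iff.2 hqt).trans_le ht⟩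
    exact ⟨q, hqt, hq, har.trans_le (hx hr hq hrq.le)⟩
  · rintro ⟨q, hqt, hq, haq⟩
    exact ⟨q, ⟨hq, haq⟩, EReal.coe_lt_coe_iff.2 hqt⟩

/-- A nondecreasing left-continuous path exceeds a level at `t > 0` iff it has done so strictly
before `t`. -/
theorem lt_iff_exceedTime_lt {That : EReal} {x : ℝ → ℝ≥0∞} (hx : MonotoneOn x (timeSet That))
    (a : ℝ≥0∞) {t : ℝ} (ht0 : 0 < t) (ht : (t : EReal) < That)
    (hlc : Tendsto x (nhdsWithin t (Iio t)) (nhds (x t))) :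
    a < x t ↔ exceedTime That x a < t := by
  constructor
  · intro h
    obtain ⟨r, hr, hr0, hrt⟩ := ((hlc.eventually (lt_mem_nhds h)).and
      (Ioo_mem_nhdsLT ht0)).exists
    refine (inf_le_right.trans (iInf₂_le r ⟨⟨hr0.le, ?_⟩, hr⟩)).trans_lt
      (EReal.coe_lt_coe_iff.2 hrt)
    exact (EReal.coe_lt_coe_iff.2 hrt).trans ht
  · rw [exceedTime_lt_iff hx a ht.le]
    rintro ⟨q, hqt, hq, haq⟩
    exact haq.trans_le (hx hq ⟨ht0.le, ht⟩ hqt.le)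

/-- For a right-continuous filtration, a time bounded by `T̂` whose strict sublevel sets are
adapted is a stopping time. -/
theorem isStopTime_of_measurableSet_lt {m : MeasurableSpace Ω} {ℱ : Filtration ℝ m}
    (hrc : ∀ t : ℝ, ℱ t = ⨅ s ∈ Ioi t, ℱ s) {That : EReal} {T : Ω → EReal}
    (hT : ∀ ω, 0 ≤ T ω ∧ T ω ≤ That)
    (hlt : ∀ t : ℝ, MeasurableSet[ℱ t] {ω | T ω < (t : EReal)}) : IsStopTime ℱ That T := by
  refine ⟨hT, fun t => ?_⟩
  rw [hrc t]
  simp only [MeasurableSpace.measurableSet_iInf]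
  intro s hs
  obtain ⟨u, -, hu, hut⟩ := exists_seq_strictAnti_tendsto' (mem_Ioi.1 hs)
  have : {ω | T ω ≤ (t : EReal)} = ⋂ n, {ω | T ω < (u n : EReal)} := by
    ext ω
    simp only [mem_ofPred_eq, mem_iInter]
    refine ⟨fun h n => h.trans_lt (EReal.coe_lt_coe_iff.2 (hu n).1), fun h => ?_⟩
    exact ge_of_tendsto' ((continuous_coe_real_ereal.tendsto t).comp hut) fun n => (h n).le
  rw [this]
  exact MeasurableSet.iInter fun n => ℱ.mono (hu n).2.le _ (hlt (u n))

/-- The first exceedance time of an adapted nondecreasing process is a stopping time. -/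
theorem isStopTime_exceedTime {m : MeasurableSpace Ω} {ℱ : Filtration ℝ m}
    (hrc : ∀ t : ℝ, ℱ t = ⨅ s ∈ Ioi t, ℱ s) {That : EReal} (hThat : 0 < That)
    {c : Ω → ℝ → ℝ≥0∞} (hc : ∀ t : ℝ, Measurable[ℱ t] fun ω => c ω t)
    (hmono : ∀ ω, MonotoneOn (c ω) (timeSet That)) (a : ℝ≥0∞) :
    IsStopTime ℱ That fun ω => exceedTime That (c ω) a := by
  refine isStopTime_of_measurableSet_lt hrc
    (fun ω => ⟨exceedTime_nonneg hThat _ _, exceedTime_le _ _ _⟩) fun t => ?_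
  rcases le_or_gt (t : EReal) That with ht | ht
  · have : {ω | exceedTime That (c ω) a < (t : EReal)} =
        ⋃ (q : ℚ) (_ : (q : ℝ) < t ∧ (q : ℝ) ∈ timeSet That), {ω | a < c ω q} := by
      ext ω
      simp [exceedTime_lt_iff (hmono ω) a ht, and_assoc]
    rw [this]
    refine MeasurableSet.iUnion fun q => MeasurableSet.iUnion fun hq => ?_
    exact ℱ.mono hq.1.le _ (hc q measurableSet_Ioi)
  · have : {ω | exceedTime That (c ω) a < (t : EReal)} = univ :=
      eq_univ_of_forall fun ω => (exceedTime_le _ _ _).trans_lt ht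
    rw [this]
    exact MeasurableSet.univ

/-- An adapted process that is nondecreasing and left-continuous on `(0,T̂)` is jointly measurable
there. -/
theorem measurable_indicator_of_monotoneOn {m : MeasurableSpace Ω} {ℱ : Filtration ℝ m}
    {That : EReal} {c : Ω → ℝ → ℝ≥0∞} (hc : ∀ t : ℝ, Measurable[ℱ t] fun ω => c ω t)
    (hmono : ∀ ω, MonotoneOn (c ω) (timeSet That))
    (hlc : ∀ ω, ∀ t : ℝ, 0 < t → (t : EReal) < That →
      Tendsto (c ω) (nhdsWithin t (Iio t)) (nhds (c ω t))) :
    Measurable ({p : Ω × ℝ | 0 < p.2 ∧ (p.2 : EReal) < That}.indicator fun p => c p.1 p.2) := by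
  have hS : MeasurableSet {p : Ω × ℝ | 0 < p.2 ∧ (p.2 : EReal) < That} :=
    (measurableSet_lt measurable_const measurable_snd).inter
      (measurableSet_lt (measurable_coe_real_ereal.comp measurable_snd) measurable_const)
  refine measurable_of_Ioi fun a => ?_
  have : ({p : Ω × ℝ | 0 < p.2 ∧ (p.2 : EReal) < That}.indicator fun p => c p.1 p.2) ⁻¹' Ioi a =
      {p : Ω × ℝ | 0 < p.2 ∧ (p.2 : EReal) < That} ∩
        ⋃ (q : ℚ) (_ : (q : ℝ) ∈ timeSet That), {ω | a < c ω q} ×ˢ Ioi (q : ℝ) := by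
    ext ⟨ω, t⟩
    by_cases h : 0 < t ∧ (t : EReal) < That
    · have := (lt_iff_exceedTime_lt (hmono ω) a h.1 h.2 (hlc ω t h.1 h.2)).trans
        (exceedTime_lt_iff (hmono ω) a h.2.le)
      simp only [mem_preimage, indicator_apply, mem_ofPred_eq, h, and_self, if_true, mem_Ioi, this,
        mem_inter_iff, true_and, mem_iUnion, mem_prod, exists_prop]
      exact exists_congr fun q => by tauto
    · simp [h]
  rw [this]
  refine hS.inter (MeasurableSet.iUnion fun q => MeasurableSet.iUnion fun _ => ?_)
  exact MeasurableSet.prod (ℱ.le q _ (hc q measurableSet_Ioi)) measurableSet_Ioi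

theorem tailInt_eq_pairE [MeasurableSpace Ω] (P : Measure Ω) (That : EReal) (kdot δ : Ω → ℝ → ℝ)
    (T : Ω → EReal) :
    tailInt P That kdot δ T =
      pairE P That kdot (fun ω t => {t : ℝ | T ω < (t : EReal)}.indicator 1 t) δ := by
  refine lintegral_congr fun ω => ?_
  have hms : MeasurableSet {t : ℝ | T ω < (t : EReal)} :=
    measurableSet_lt measurable_const measurable_coe_real_ereal
  have hae : (timeSet That ∩ {t : ℝ | T ω ≤ (t : EReal)} : Set ℝ) =ᵐ[volume]
      ({t : ℝ | T ω < (t : EReal)} ∩ timeSet That : Set ℝ) := by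
    filter_upwards [Measure.ae_ne volume (T ω).toReal] with t ht
    have hne : T ω ≠ (t : EReal) := fun h => ht (by rw [h, EReal.toReal_coe])
    have : T ω ≤ (t : EReal) ↔ T ω < (t : EReal) := ⟨fun h => h.lt_of_ne hne, le_of_lt⟩
    exact propext ⟨fun h => ⟨this.1 h.2, h.1⟩, fun h => ⟨h.2, this.2 h.1⟩⟩
  rw [setLIntegral_congr hae, ← Measure.restrict_restrict hms, ← lintegral_indicator hms]
  refine lintegral_congr fun t => ?_
  simp [indicator_apply]

/-- The pairing with an adapted nondecreasing left-continuous process is a mixture of tail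
integrals over its exceedance times. -/
theorem pairE_eq_lintegral_tailInt {m : MeasurableSpace Ω} (P : Measure Ω) [SFinite P]
    {ℱ : Filtration ℝ m} {That : EReal} {kdot δ : Ω → ℝ → ℝ}
    (hk : IsStronglyProgressive ℱ (fun t ω => kdot ω t)) (hδ : IsStronglyProgressive ℱ (fun t ω => δ ω t))
    {c : Ω → ℝ → ℝ≥0∞} (hc : ∀ t : ℝ, Measurable[ℱ t] fun ω => c ω t)
    (hmono : ∀ ω, MonotoneOn (c ω) (timeSet That))
    (hlc : ∀ ω, ∀ t : ℝ, 0 < t → (t : EReal) < That →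
      Tendsto (c ω) (nhdsWithin t (Iio t)) (nhds (c ω t))) :
    pairE P That kdot c δ = ∫⁻ s in Ioi (0 : ℝ),
      tailInt P That kdot δ fun ω => exceedTime That (c ω) (ENNReal.ofReal s) := by
  set f : Ω × ℝ → ℝ≥0∞ :=
    {p : Ω × ℝ | 0 < p.2 ∧ (p.2 : EReal) < That}.indicator fun p => c p.1 p.2 with hf_def
  set g : Ω × ℝ → ℝ≥0∞ :=
    fun p => ENNReal.ofReal (δ p.1 p.2) * ENNReal.ofReal (kdot p.1 p.2) with hg_def
  have hf : Measurable f := measurable_indicator_of_monotoneOn hc hmono hlc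
  have hg : Measurable g := (measurable_uncurry_of_isStronglyProgressive hδ).ennreal_ofReal.mul
    (measurable_uncurry_of_isStronglyProgressive hk).ennreal_ofReal
  have hpos : ∀ᵐ t : ℝ ∂(volume.restrict (timeSet That)), 0 < t ∧ (t : EReal) < That := by
    filter_upwards [ae_restrict_mem (measurableSet_timeSet That),
      ae_restrict_of_ae (Measure.ae_ne volume (0 : ℝ))] with t ht ht0
    exact ⟨ht.1.lt_of_ne' ht0, ht.2⟩
  calc pairE P That kdot c δ
      = ∫⁻ p, f p * g p ∂(P.prod (volume.restrict (timeSet That))) := by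
        rw [lintegral_prod (fun p => f p * g p) (hf.mul hg).aemeasurable]
        refine lintegral_congr fun ω => lintegral_congr_ae ?_
        filter_upwards [hpos] with t ht
        simp [hf_def, hg_def, ht, mul_assoc]
    _ = _ := lintegral_mul_eq_lintegral_setLIntegral_superlevel _ hf hg
    _ = _ := by
        refine lintegral_congr fun s => ?_
        have hms : MeasurableSet {p | ENNReal.ofReal s < f p} :=
          measurableSet_lt measurable_const hf
        rw [tailInt_eq_pairE, ← lintegral_indicator hms,
          lintegral_prod _ (hg.indicator hms).aemeasurable]
        refine lintegral_congr fun ω => lintegral_congr_ae ?_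
        filter_upwards [hpos] with t ht
        have := lt_iff_exceedTime_lt (hmono ω) (ENNReal.ofReal s) ht.1 ht.2 (hlc ω t ht.1 ht.2)
        simp [hf_def, hg_def, indicator_apply, ht, this]

/-- The chronological ordering `δ' ⪯ δ` holds if and only if
`⟨c,δ'⟩ ≤ ⟨c,δ⟩` for every adapted `[0,∞]`-valued process `c` whose paths are
nondecreasing and left-continuous on `[0,T̂)` with `c_0 = 0`. -/
theorem chronLE_iff_pair_mono
    {m : MeasurableSpace Ω} (P : Measure Ω) [IsProbabilityMeasure P]
    (ℱ : Filtration ℝ m)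
    (hrc : ∀ t : ℝ, ℱ t = ⨅ s ∈ Set.Ioi t, ℱ s)
    (hcomplete : ∀ s : Set Ω, MeasurableSet s → P s = 0 → ∀ t : ℝ, MeasurableSet[ℱ t] s)
    (That : EReal) (hThat : 0 < That)
    (kdot : Ω → ℝ → ℝ) (hkprog : ProgMeasurable ℱ (fun t ω => kdot ω t))
    (hkpos : ∀ ω, ∀ t ∈ timeSet That, 0 < kdot ω t)
    (A : ℝ) (hkbdd : ∀ ω, (∫⁻ t in timeSet That, ENNReal.ofReal (kdot ω t)) ≤ ENNReal.ofReal A)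
    (δ' δ : Ω → ℝ → ℝ)
    (hδ'nn : ∀ ω t, 0 ≤ δ' ω t) (hδnn : ∀ ω t, 0 ≤ δ ω t)
    (hδ'prog : ProgMeasurable ℱ (fun t ω => δ' ω t))
    (hδprog : ProgMeasurable ℱ (fun t ω => δ ω t)) :
    chronLE P That kdot ℱ δ' δ ↔
      ∀ c : Ω → ℝ → ℝ≥0∞,
        (∀ t : ℝ, Measurable[ℱ t] fun ω => c ω t) →
        (∀ ω, MonotoneOn (c ω) (timeSet That)) →
        (∀ ω, ∀ t : ℝ, 0 < t → (t : EReal) < That →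
          Filter.Tendsto (c ω) (nhdsWithin t (Set.Iio t)) (nhds (c ω t))) →
        (∀ ω, c ω 0 = 0) →
        pairE P That kdot c δ' ≤ pairE P That kdot c δ := by
  constructor
  · intro h c hc hmono hlc _
    rw [pairE_eq_lintegral_tailInt P hkprog hδ'prog hc hmono hlc,
      pairE_eq_lintegral_tailInt P hkprog hδprog hc hmono hlc]
    exact lintegral_mono fun s => h _ (isStopTime_exceedTime hrc hThat hc hmono _)
  · intro h T hT
    rw [tailInt_eq_pairE, tailInt_eq_pairE]
    refine h _ (fun t => ?_) (fun ω s _ t _ hst => ?_) (fun ω t _ _ => ?_) (fun ω => ?_)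
    · have hlt : MeasurableSet[ℱ t] {ω | T ω < (t : EReal)} := by
        have : {ω | T ω < (t : EReal)} =
            ⋃ (q : ℚ) (_ : (q : ℝ) < t), {ω | T ω ≤ ((q : ℝ) : EReal)} := by
          ext ω
          simp only [mem_ofPred_eq, mem_iUnion, exists_prop]
          constructor
          · intro hω
            obtain ⟨q, hq, hqt⟩ := EReal.lt_iff_exists_rat_btwn.1 hω
            exact ⟨q, EReal.coe_lt_coe_iff.1 hqt, hq.le⟩
          · rintro ⟨q, hqt, hq⟩
            exact hq.trans_lt (EReal.coe_lt_coe_iff.2 hqt)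
        rw [this]
        exact MeasurableSet.iUnion fun q => MeasurableSet.iUnion fun hq =>
          ℱ.mono hq.le _ (hT.2 q)
      exact Measurable.ite hlt measurable_const measurable_const
    · by_cases hs : T ω < (s : EReal)
      · simp [hs, hs.trans_le (EReal.coe_le_coe_iff.2 hst)]
      · simp [hs]
    · refine tendsto_const_nhds.congr' ?_
      by_cases ht : T ω < (t : EReal)
      · filter_upwards [mem_nhdsWithin_of_mem_nhds
          ((isOpen_lt continuous_const continuous_coe_real_ereal).mem_nhds ht)] with s hs
        have hs : T ω < (s : EReal) := hs
        simp [hs, ht]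
      · filter_upwards [self_mem_nhdsWithin] with s hs
        have hs : ¬ T ω < (s : EReal) := fun h => ht (h.trans (EReal.coe_lt_coe_iff.2 hs))
        simp [hs, ht]
    · simp [not_lt.2 (hT.1 ω).1]
end
end

section
/- Let E be a convex subset of the nonnegative jointly measurable processes on Ω × [0,T̂). If for every ε > 0 there exists c^ε ∈ εE with E[∫_0^{T̂} U(ω,t,c^ε_t) dκ_t] > −∞, then for every x > 0: sup_{c ∈ xE} E[∫_0^{T̂} U(ω,t,c_t) dκ_t] = sup_{c ∈ x·cl(E)} E[∫_0^{T̂} U(ω,t,c_t) dκ_t], where cl(E) denotes the closure of E with respect to convergence in the finite measure P⊗dκ. -/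
open MeasureTheory ENNReal Filter Set

noncomputable section

variable {Ω : Type*}

/-- The positive part of an extended real, as an element of `[0,∞]`. -/
def erealPosPart (e : EReal) : ℝ≥0∞ := if e = ⊤ then ⊤ else ENNReal.ofReal e.toReal

/-- Expected utility `E[∫_0^T̂ U(ω,t,c_t) dκ_t] ∈ ℝ ∪ {±∞}`, with the convention that it
equals `−∞` whenever the negative part of `U(·,·,c)` has infinite integral. -/
def EU [MeasurableSpace Ω] (P : Measure Ω) (That : EReal) (kdot : Ω → ℝ → ℝ)
    (U : Ω → ℝ → ℝ → EReal) (c : Ω → ℝ → ℝ) : EReal :=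
  if (∫⁻ p, erealPosPart (-(U p.1 p.2 (c p.1 p.2))) ∂(Pkappa P That kdot)) = ⊤ then ⊥
  else ((∫⁻ p, erealPosPart (U p.1 p.2 (c p.1 p.2)) ∂(Pkappa P That kdot)) : ℝ≥0∞)
    - ((∫⁻ p, erealPosPart (-(U p.1 p.2 (c p.1 p.2))) ∂(Pkappa P That kdot)) : ℝ≥0∞)

/-- The closure of a set of processes with respect to convergence in `P⊗dκ`-measure
(within the nonnegative jointly measurable processes). -/
def closInMeasure [MeasurableSpace Ω] (μ : Measure (Ω × ℝ)) (E : Set (Ω → ℝ → ℝ)) :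
    Set (Ω → ℝ → ℝ) :=
  {c | (∀ ω t, 0 ≤ c ω t) ∧ Measurable (Function.uncurry c) ∧
    ∃ u : ℕ → Ω → ℝ → ℝ, (∀ n, u n ∈ E) ∧
      TendstoInMeasure μ (fun n => Function.uncurry (u n)) Filter.atTop (Function.uncurry c)}

open Topology

section ExtendedIntegral

variable {α : Type*} [MeasurableSpace α]

/-- The integral of an extended real function, equal to `−∞` whenever the negative part has
infinite integral. -/
def erealIntegral (μ : Measure α) (f : α → EReal) : EReal :=
  if (∫⁻ a, (-f a).toENNReal ∂μ) = ⊤ then ⊥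
  else ((∫⁻ a, (f a).toENNReal ∂μ : ℝ≥0∞) : EReal) - ((∫⁻ a, (-f a).toENNReal ∂μ : ℝ≥0∞) : EReal)

variable {μ : Measure α}

lemma lintegral_neg_ne_top_of_erealIntegral_ne_bot {f : α → EReal}
    (h : erealIntegral μ f ≠ ⊥) : (∫⁻ a, (-f a).toENNReal ∂μ) ≠ ⊤ := by
  intro h'
  exact h (if_pos h')

lemma erealIntegral_mono_ae {f g : α → EReal} (h : ∀ᵐ a ∂μ, f a ≤ g a) :
    erealIntegral μ f ≤ erealIntegral μ g := by
  have hneg : (∫⁻ a, (-g a).toENNReal ∂μ) ≤ ∫⁻ a, (-f a).toENNReal ∂μ :=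
    lintegral_mono_ae (h.mono fun a ha => EReal.toENNReal_le_toENNReal (EReal.neg_le_neg_iff.2 ha))
  have hpos : (∫⁻ a, (f a).toENNReal ∂μ) ≤ ∫⁻ a, (g a).toENNReal ∂μ :=
    lintegral_mono_ae (h.mono fun a ha => EReal.toENNReal_le_toENNReal ha)
  by_cases hf : (∫⁻ a, (-f a).toENNReal ∂μ) = ⊤
  · simp [erealIntegral, hf]
  · rw [erealIntegral, erealIntegral, if_neg hf, if_neg (ne_top_of_le_ne_top hf hneg)]
    exact EReal.sub_le_sub (EReal.coe_ennreal_le_coe_ennreal_iff.2 hpos)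
      (EReal.coe_ennreal_le_coe_ennreal_iff.2 hneg)

lemma ae_ne_bot_of_erealIntegral_ne_bot {f : α → EReal} (hf : Measurable f)
    (h : erealIntegral μ f ≠ ⊥) : ∀ᵐ a ∂μ, f a ≠ ⊥ := by
  have := ae_lt_top hf.neg.ereal_toENNReal (lintegral_neg_ne_top_of_erealIntegral_ne_bot h)
  filter_upwards [this] with a ha hbot
  simp [hbot] at ha

/-- Fatou's lemma for extended real functions whose negative parts have an integrable bound. -/
lemma eventually_lt_erealIntegral {F : ℕ → α → EReal} {f : α → EReal} {G : α → ℝ≥0∞}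
    (hF : ∀ n, Measurable (F n)) (hG : (∫⁻ a, G a ∂μ) ≠ ⊤)
    (hFG : ∀ n, ∀ᵐ a ∂μ, (-F n a).toENNReal ≤ G a)
    (hlim : ∀ᵐ a ∂μ, Tendsto (fun n => F n a) atTop (𝓝 (f a)))
    {r : ℝ} (hr : (r : EReal) < erealIntegral μ f) :
    ∀ᶠ n in atTop, (r : EReal) < erealIntegral μ (F n) := by
  have hcont : Continuous EReal.toENNReal := EReal.continuous_toENNReal
  have hneg : Tendsto (fun n => ∫⁻ a, (-F n a).toENNReal ∂μ) atTop
      (𝓝 (∫⁻ a, (-f a).toENNReal ∂μ)) :=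
    tendsto_lintegral_of_dominated_convergence G (fun n => (hF n).neg.ereal_toENNReal) hFG hG
      (hlim.mono fun a ha => ((hcont.comp continuous_neg).tendsto _).comp ha)
  have hpos : (∫⁻ a, (f a).toENNReal ∂μ) ≤
      liminf (fun n => ∫⁻ a, (F n a).toENNReal ∂μ) atTop := by
    refine le_trans (le_of_eq ?_) (lintegral_liminf_le fun n => (hF n).ereal_toENNReal)
    exact lintegral_congr_ae
      (hlim.mono fun a ha => ((hcont.tendsto _).comp ha).liminf_eq.symm)
  have hfin : (∫⁻ a, (-f a).toENNReal ∂μ) ≠ ⊤ :=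
    lintegral_neg_ne_top_of_erealIntegral_ne_bot (ne_bot_of_gt hr)
  have hFfin : ∀ n, (∫⁻ a, (-F n a).toENNReal ∂μ) ≠ ⊤ := fun n =>
    ne_top_of_le_ne_top hG (lintegral_mono_ae (hFG n))
  rw [erealIntegral, if_neg hfin, EReal.lt_sub_iff_add_lt (by simp) (by simp [hfin])] at hr
  obtain ⟨m, hm₁, hm₂⟩ := exists_between hr
  have hadd : Tendsto (fun n => (r : EReal) + ((∫⁻ a, (-F n a).toENNReal ∂μ : ℝ≥0∞) : EReal))
      atTop (𝓝 ((r : EReal) + ((∫⁻ a, (-f a).toENNReal ∂μ : ℝ≥0∞) : EReal))) :=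
    (EReal.continuousAt_add (.inl (EReal.coe_ne_top r)) (.inl (EReal.coe_ne_bot r))).tendsto.comp
      (tendsto_const_nhds.prodMk_nhds ((continuous_coe_ennreal_ereal.tendsto _).comp hneg))
  have hmF : ∀ᶠ n in atTop, m < ((∫⁻ a, (F n a).toENNReal ∂μ : ℝ≥0∞) : EReal) := by
    rcases le_or_gt 0 m with h0 | h0
    · lift m to ℝ≥0∞ using h0
      rw [EReal.coe_ennreal_lt_coe_ennreal_iff] at hm₂
      filter_upwards [eventually_lt_of_lt_liminf (hm₂.trans_le hpos)] with n hn
      exact EReal.coe_ennreal_lt_coe_ennreal_iff.2 hn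
    · exact Eventually.of_forall fun n => h0.trans_le (EReal.coe_ennreal_nonneg _)
  filter_upwards [hadd.eventually_lt_const hm₁, hmF] with n h₁ h₂
  rw [erealIntegral, if_neg (hFfin n), EReal.lt_sub_iff_add_lt (by simp) (by simp [hFfin n])]
  exact h₁.trans h₂

lemma toENNReal_neg_convex_comb_le {θ : ℝ} (h0 : 0 ≤ θ) (h1 : θ ≤ 1) (a b : ℝ) :
    (-(((1 - θ) * a + θ * b : ℝ) : EReal)).toENNReal ≤
      (-(a : EReal)).toENNReal + (-(b : EReal)).toENNReal := by
  simp only [← EReal.coe_neg, EReal.toENNReal_of_ne_top (EReal.coe_ne_top _), EReal.toReal_coe]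
  have ha : -a ≤ max (-a) 0 := le_max_left _ _
  have hb : -b ≤ max (-b) 0 := le_max_left _ _
  have ha' : 0 ≤ max (-a) 0 := le_max_right _ _
  have hb' : 0 ≤ max (-b) 0 := le_max_right _ _
  calc ENNReal.ofReal (-((1 - θ) * a + θ * b))
      ≤ ENNReal.ofReal (max (-a) 0 + max (-b) 0) := ENNReal.ofReal_le_ofReal (by nlinarith)
    _ = _ := by rw [ENNReal.ofReal_add ha' hb']; simp

/-- Small perturbations of `g` towards `h` almost preserve the integral of `g`. -/
lemma exists_lt_erealIntegral_convex_comb {g h : α → EReal} (hg : Measurable g)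
    (hh : Measurable h) (hgtop : ∀ a, g a ≠ ⊤) (hhtop : ∀ a, h a ≠ ⊤)
    (hgbot : erealIntegral μ g ≠ ⊥) (hhbot : erealIntegral μ h ≠ ⊥)
    {r : ℝ} (hr : (r : EReal) < erealIntegral μ g) :
    ∃ θ : ℝ, 0 < θ ∧ θ < 1 ∧ (r : EReal) <
      erealIntegral μ (fun a => (((1 - θ) * (g a).toReal + θ * (h a).toReal : ℝ) : EReal)) := by
  have hθ0 : Tendsto (fun n : ℕ => (1 / ((n : ℝ) + 1) : ℝ)) atTop (𝓝 0) :=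
    tendsto_one_div_add_atTop_nhds_zero_nat
  have hgr := ae_ne_bot_of_erealIntegral_ne_bot hg hgbot
  have hhr := ae_ne_bot_of_erealIntegral_ne_bot hh hhbot
  have key := eventually_lt_erealIntegral (μ := μ) (f := g)
    (F := fun (n : ℕ) a => (((1 - 1 / ((n : ℝ) + 1)) * (g a).toReal
      + 1 / ((n : ℝ) + 1) * (h a).toReal : ℝ) : EReal))
    (G := fun a => (-g a).toENNReal + (-h a).toENNReal)
    (fun n => ((hg.ereal_toReal.const_mul _).add (hh.ereal_toReal.const_mul _)).coe_real_ereal)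
    (by
      rw [lintegral_add_left (f := fun a => (-g a).toENNReal) hg.neg.ereal_toENNReal]
      exact ENNReal.add_ne_top.2 ⟨lintegral_neg_ne_top_of_erealIntegral_ne_bot hgbot,
        lintegral_neg_ne_top_of_erealIntegral_ne_bot hhbot⟩)
    (fun n => by
      filter_upwards [hgr, hhr] with a ha hb
      have := toENNReal_neg_convex_comb_le (θ := 1 / ((n : ℝ) + 1)) (by positivity)
        (by rw [div_le_one (by positivity)]; linarith [Nat.cast_nonneg (α := ℝ) n])
        (g a).toReal (h a).toReal
      rwa [EReal.coe_toReal (hgtop a) ha, EReal.coe_toReal (hhtop a) hb] at this)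
    (by
      filter_upwards [hgr] with a ha
      have : Tendsto (fun n : ℕ => (1 - 1 / ((n : ℝ) + 1)) * (g a).toReal
          + 1 / ((n : ℝ) + 1) * (h a).toReal) atTop (𝓝 ((1 - 0) * (g a).toReal
          + 0 * (h a).toReal)) :=
        ((tendsto_const_nhds.sub hθ0).mul_const _).add (hθ0.mul_const _)
      have h2 := (continuous_coe_real_ereal.tendsto _).comp this
      simpa [EReal.coe_toReal (hgtop a) ha, Function.comp_def] using h2)
    hr
  obtain ⟨n, hn, hn1⟩ := (key.and (eventually_ge_atTop 1)).exists
  refine ⟨1 / ((n : ℝ) + 1), by positivity, ?_, hn⟩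
  have : (1 : ℝ) ≤ n := by exact_mod_cast hn1
  rw [div_lt_one (by positivity)]
  linarith

end ExtendedIntegral

section UtilityFunction

variable {V : ℝ → EReal}

lemma continuousOn_Ici_of_continuousOn_toReal (htop : ∀ x, 0 ≤ x → V x ≠ ⊤)
    (hbot : ∀ x, 0 < x → V x ≠ ⊥) (hcont : ∀ x, 0 < x → ContinuousAt (fun y => (V y).toReal) x)
    (h0 : Tendsto V (𝓝[>] 0) (𝓝 (V 0))) : ContinuousOn V (Ici 0) := by
  intro x hx
  rcases (mem_Ici.1 hx).eq_or_lt with rfl | hx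
  · exact continuousWithinAt_Ioi_iff_Ici.1 h0
  · have h1 : ContinuousAt (fun y => ((V y).toReal : EReal)) x :=
      continuous_coe_real_ereal.continuousAt.comp (hcont x hx)
    refine (h1.congr ?_).continuousWithinAt
    filter_upwards [lt_mem_nhds hx] with y hy
    exact EReal.coe_toReal (htop y hy.le) (hbot y hy)

/-- Concavity of the real values on `(0,∞)` extends to `[0,∞)` by continuity. -/
lemma convex_comb_toReal_le (htop : ∀ x, 0 ≤ x → V x ≠ ⊤) (hbot : ∀ x, 0 < x → V x ≠ ⊥)
    (hcont : ContinuousOn V (Ici 0)) (hconc : ConcaveOn ℝ (Ioi 0) fun x => (V x).toReal)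
    {a b θ : ℝ} (ha : 0 ≤ a) (hb : 0 ≤ b) (hVa : V a ≠ ⊥) (hVb : V b ≠ ⊥)
    (h0 : 0 ≤ θ) (h1 : θ ≤ 1) :
    (((1 - θ) * (V a).toReal + θ * (V b).toReal : ℝ) : EReal) ≤ V ((1 - θ) * a + θ * b) := by
  have shift : ∀ z : ℝ, 0 ≤ z → Tendsto (fun s => V (z + s)) (𝓝[>] 0) (𝓝 (V z)) := by
    intro z hz
    refine (hcont z hz).tendsto.comp (tendsto_nhdsWithin_iff.2 ⟨?_, ?_⟩)
    · have : Tendsto (fun s : ℝ => z + s) (𝓝 0) (𝓝 (z + 0)) := tendsto_const_nhds.add tendsto_id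
      rw [add_zero] at this
      exact this.mono_left nhdsWithin_le_nhds
    · filter_upwards [self_mem_nhdsWithin] with s hs
      exact add_nonneg hz (mem_Ioi.1 hs).le
  have shiftReal : ∀ z : ℝ, 0 ≤ z → V z ≠ ⊥ →
      Tendsto (fun s => (V (z + s)).toReal) (𝓝[>] 0) (𝓝 (V z).toReal) := fun z hz hVz =>
    (EReal.tendsto_toReal (htop z hz) hVz).comp (shift z hz)
  have hz : 0 ≤ (1 - θ) * a + θ * b :=
    add_nonneg (mul_nonneg (sub_nonneg.2 h1) ha) (mul_nonneg h0 hb)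
  have hleft : Tendsto (fun s => (((1 - θ) * (V (a + s)).toReal + θ * (V (b + s)).toReal : ℝ)
      : EReal)) (𝓝[>] 0) (𝓝 (((1 - θ) * (V a).toReal + θ * (V b).toReal : ℝ) : EReal)) :=
    (continuous_coe_real_ereal.tendsto _).comp
      (((shiftReal a ha hVa).const_mul _).add ((shiftReal b hb hVb).const_mul _))
  refine le_of_tendsto_of_tendsto hleft (shift _ hz) ?_
  filter_upwards [self_mem_nhdsWithin] with s hs
  have hs : 0 < s := hs
  have := hconc.2 (x := a + s) (y := b + s) (mem_Ioi.2 (by linarith)) (mem_Ioi.2 (by linarith))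
    (sub_nonneg.2 h1) h0 (by ring)
  simp only [smul_eq_mul] at this
  rw [show (1 - θ) * (a + s) + θ * (b + s) = (1 - θ) * a + θ * b + s by ring] at this
  rw [← EReal.coe_toReal (htop _ (add_nonneg hz hs.le)) (hbot _ (add_pos_of_nonneg_of_pos hz hs))]
  exact EReal.coe_le_coe_iff.2 this

end UtilityFunction

/-- A Carathéodory field composed with a nonnegative measurable function is measurable. -/
lemma measurable_comp_of_continuousOn_Ici {α : Type*} [MeasurableSpace α] {U : α → ℝ → EReal}
    (hcont : ∀ a, ContinuousOn (U a) (Ici 0)) (hmeas : ∀ x, 0 ≤ x → Measurable fun a => U a x)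
    {c : α → ℝ} (hc : Measurable c) (hc0 : ∀ a, 0 ≤ c a) : Measurable fun a => U a (c a) := by
  have h := measurable_uncurry_of_continuous_of_measurable
    (u := fun (y : NNReal) (a : α) => U a y)
    (fun a => (hcont a).comp_continuous NNReal.continuous_coe fun y => y.2)
    (fun y => hmeas y y.2)
  have h2 := h.comp (hc.real_toNNReal.prodMk measurable_id)
  simpa [Function.uncurry, Function.comp_def, hc0] using h2

/-- Let `E` be a convex set of nonnegative processes. If for every `ε > 0` there is
`c^ε ∈ εE` with expected utility `> −∞`, then for every `x > 0` the supremum of expected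
utility over `xE` coincides with the supremum over `x·cl(E)`, where `cl(E)` is the closure
of `E` in `P⊗dκ`-measure. -/
theorem sup_expected_utility_eq_sup_over_closure
    [MeasurableSpace Ω] (P : Measure Ω) [IsProbabilityMeasure P]
    (That : EReal) (hThat : 0 < That)
    (kdot : Ω → ℝ → ℝ) (hkmeas : Measurable (Function.uncurry kdot))
    (hkpos : ∀ ω, ∀ t ∈ timeSet That, 0 < kdot ω t)
    (A : ℝ) (hkbdd : ∀ ω, (∫⁻ t in timeSet That, ENNReal.ofReal (kdot ω t)) ≤ ENNReal.ofReal A)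
    -- the utility stochastic field
    (U : Ω → ℝ → ℝ → EReal) (U' : Ω → ℝ → ℝ → ℝ)
    (hUnotTop : ∀ ω t x, 0 ≤ x → U ω t x ≠ ⊤)
    (hUfin : ∀ ω t x, 0 < x → U ω t x ≠ ⊥)
    (hUmono : ∀ ω t, MonotoneOn (fun x => U ω t x) (Set.Ici (0:ℝ)))
    (hUconc : ∀ ω t, StrictConcaveOn ℝ (Set.Ioi (0:ℝ)) (fun x => (U ω t x).toReal))
    (hUderiv : ∀ ω t, ∀ x : ℝ, 0 < x →
      HasDerivAt (fun y => (U ω t y).toReal) (U' ω t x) x)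
    (hU'cont : ∀ ω t, ContinuousOn (U' ω t) (Set.Ioi (0:ℝ)))
    (hInada0 : ∀ ω t, Filter.Tendsto (U' ω t) (nhdsWithin 0 (Set.Ioi 0)) Filter.atTop)
    (hInadaInf : ∀ ω t, Filter.Tendsto (U' ω t) Filter.atTop (nhds 0))
    (hU0 : ∀ ω t, Filter.Tendsto (fun x => U ω t x) (nhdsWithin 0 (Set.Ioi 0))
      (nhds (U ω t 0)))
    (hUmeas : ∀ x : ℝ, 0 ≤ x → Measurable (fun p : Ω × ℝ => U p.1 p.2 x))
    -- the convex set `E` of nonnegative processes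
    (E : Set (Ω → ℝ → ℝ))
    (hEamb : ∀ c ∈ E, (∀ ω t, 0 ≤ c ω t) ∧ Measurable (Function.uncurry c))
    (hEconv : ∀ c₁ ∈ E, ∀ c₂ ∈ E, ∀ θ : ℝ, 0 ≤ θ → θ ≤ 1 →
      (fun ω t => θ * c₁ ω t + (1 - θ) * c₂ ω t) ∈ E)
    -- for every `ε > 0` there is `c^ε ∈ εE` with finite expected utility
    (hfin : ∀ ε : ℝ, 0 < ε → ∃ c₀ ∈ E,
      EU P That kdot U (fun ω t => ε * c₀ ω t) ≠ ⊥) :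
    ∀ x : ℝ, 0 < x →
      (⨆ c ∈ E, EU P That kdot U (fun ω t => x * c ω t))
        = ⨆ c ∈ closInMeasure (Pkappa P That kdot) E,
            EU P That kdot U (fun ω t => x * c ω t) := by
  intro x hx
  set μ := Pkappa P That kdot
  have hEU : ∀ c : Ω → ℝ → ℝ, EU P That kdot U c =
      erealIntegral μ fun p => U p.1 p.2 (c p.1 p.2) := fun c => rfl
  have hcont : ∀ p : Ω × ℝ, ContinuousOn (U p.1 p.2) (Ici 0) := fun p =>
    continuousOn_Ici_of_continuousOn_toReal (hUnotTop p.1 p.2) (hUfin p.1 p.2)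
      (fun y hy => (hUderiv p.1 p.2 y hy).continuousAt) (hU0 p.1 p.2)
  have hmeas : ∀ c : Ω × ℝ → ℝ, Measurable c → (∀ p, 0 ≤ c p) →
      Measurable fun p : Ω × ℝ => U p.1 p.2 (c p) := fun c hc hc0 =>
    measurable_comp_of_continuousOn_Ici (U := fun p : Ω × ℝ => U p.1 p.2) hcont hUmeas hc hc0
  refine le_antisymm (biSup_mono fun c hc => ?_) (iSup₂_le fun c hc => ?_)
  · refine ⟨(hEamb c hc).1, (hEamb c hc).2, fun _ => c, fun _ => hc, ?_⟩
    intro ε hε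
    simp [hε.ne']
  refine EReal.ge_of_forall_gt_iff_ge.1 fun r hr => ?_
  obtain ⟨hc0, hcm, u, huE, hu⟩ := hc
  obtain ⟨φ, -, hφ⟩ := hu.exists_seq_tendsto_ae
  obtain ⟨c₁, hc₁E, hc₁⟩ := hfin (x / 2) (by positivity)
  obtain ⟨hc₁0, hc₁m⟩ := hEamb c₁ hc₁E
  rw [hEU] at hr hc₁
  have hgm := hmeas (fun p => x * c p.1 p.2) (hcm.const_mul x)
    fun p => mul_nonneg hx.le (hc0 _ _)
  have hhm := hmeas (fun p => x / 2 * c₁ p.1 p.2) (hc₁m.const_mul (x / 2))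
    fun p => mul_nonneg (by positivity) (hc₁0 _ _)
  have hgbot := ne_bot_of_gt hr
  obtain ⟨θ, hθ0, hθ1, hθ⟩ := exists_lt_erealIntegral_convex_comb hgm hhm
    (fun p => hUnotTop _ _ _ (mul_nonneg hx.le (hc0 _ _)))
    (fun p => hUnotTop _ _ _ (mul_nonneg (by positivity) (hc₁0 _ _))) hgbot hc₁ hr
  have hθx : 0 < θ * x / 2 := by positivity
  obtain ⟨c₂, hc₂E, hc₂⟩ := hfin (θ * x / 2) hθx
  obtain ⟨hc₂0, hc₂m⟩ := hEamb c₂ hc₂E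
  rw [hEU] at hc₂
  have hvE := hEconv c₁ hc₁E c₂ hc₂E (1 / 2) (by norm_num) (by norm_num)
  have hwE : ∀ n, (fun ω t => θ * (1 / 2 * c₁ ω t + (1 - 1 / 2) * c₂ ω t)
      + (1 - θ) * u (φ n) ω t) ∈ E := fun n =>
    hEconv _ hvE _ (huE (φ n)) θ hθ0.le hθ1.le
  have hlim : (r : EReal) < erealIntegral μ fun p => U p.1 p.2
      (x * (θ * (1 / 2 * c₁ p.1 p.2 + (1 - 1 / 2) * c₂ p.1 p.2) + (1 - θ) * c p.1 p.2)) := by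
    refine hθ.trans_le (erealIntegral_mono_ae ?_)
    filter_upwards [ae_ne_bot_of_erealIntegral_ne_bot hgm hgbot,
      ae_ne_bot_of_erealIntegral_ne_bot hhm hc₁] with p hp₁ hp₂
    have hn1 := mul_nonneg hx.le (hc0 p.1 p.2)
    have hn2 := mul_nonneg (half_pos hx).le (hc₁0 p.1 p.2)
    have hn3 := mul_nonneg hθx.le (hc₂0 p.1 p.2)
    have hn : 0 ≤ (1 - θ) * (x * c p.1 p.2) + θ * (x / 2 * c₁ p.1 p.2) :=
      add_nonneg (mul_nonneg (by linarith) hn1) (mul_nonneg hθ0.le hn2)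
    refine (convex_comb_toReal_le (hUnotTop p.1 p.2) (hUfin p.1 p.2) (hcont p)
      (hUconc p.1 p.2).concaveOn hn1 hn2 hp₁ hp₂ hθ0.le hθ1.le).trans ?_
    have hle : (1 - θ) * (x * c p.1 p.2) + θ * (x / 2 * c₁ p.1 p.2) ≤
        x * (θ * (1 / 2 * c₁ p.1 p.2 + (1 - 1 / 2) * c₂ p.1 p.2) + (1 - θ) * c p.1 p.2) := by
      linarith
    exact hUmono p.1 p.2 hn (hn.trans hle) hle
  have hwlim := eventually_lt_erealIntegral (μ := μ)
    (F := fun n p => U p.1 p.2 (x * (θ * (1 / 2 * c₁ p.1 p.2 + (1 - 1 / 2) * c₂ p.1 p.2)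
      + (1 - θ) * u (φ n) p.1 p.2)))
    (fun n => hmeas _ ((hEamb _ (hwE n)).2.const_mul x)
      fun p => mul_nonneg hx.le ((hEamb _ (hwE n)).1 p.1 p.2))
    (lintegral_neg_ne_top_of_erealIntegral_ne_bot hc₂)
    (fun n => Eventually.of_forall fun p => by
      have hn1 := mul_nonneg (mul_nonneg hx.le (sub_nonneg.2 hθ1.le))
        ((hEamb _ (huE (φ n))).1 p.1 p.2)
      have hn2 := mul_nonneg hθx.le (hc₁0 p.1 p.2)
      have hn3 := mul_nonneg hθx.le (hc₂0 p.1 p.2)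
      have hle : θ * x / 2 * c₂ p.1 p.2 ≤ x * (θ * (1 / 2 * c₁ p.1 p.2
          + (1 - 1 / 2) * c₂ p.1 p.2) + (1 - θ) * u (φ n) p.1 p.2) := by
        linarith
      exact EReal.toENNReal_le_toENNReal
        (EReal.neg_le_neg_iff.2 (hUmono p.1 p.2 hn3 (hn3.trans hle) hle)))
    (by
      filter_upwards [hφ] with p hp
      refine (hcont p _ ?_).tendsto.comp (tendsto_nhdsWithin_iff.2 ⟨?_, ?_⟩)
      · exact mul_nonneg hx.le (add_nonneg (mul_nonneg hθ0.le
          ((hEamb _ hvE).1 p.1 p.2)) (mul_nonneg (sub_nonneg.2 hθ1.le) (hc0 _ _)))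
      · exact (tendsto_const_nhds.add (hp.const_mul (1 - θ))).const_mul x
      · exact Eventually.of_forall fun n => mul_nonneg hx.le ((hEamb _ (hwE n)).1 p.1 p.2))
    hlim
  obtain ⟨n, hn⟩ := hwlim.exists
  exact hn.le.trans (le_iSup₂_of_le _ (hwE n) le_rfl)
end
end
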